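/- Suppose σ ∈ Runs(M₀,α₀,𝒢), (M₀,α₀) —σ→ (M,α), and ⟦C_loop⟧(s_{M,α}, σ)(s', σσ') > 0 for a program state s' and run σ'. Then (i) σσ' ∈ Runs(M₀,α₀,𝒢), (ii) s' is observable, and (iii) (M,α) —σ'→ (M_{s'}, α_{s'}), where M_{s'}(p) = s'(p̲) and α_{s'}(v) = s'(v̲). -/

import Mathlib

open scoped ENNReal
open scoped Classical

noncomputable section

/-! ## Data Petri nets -/

/-- A Data Petri net over places `P`, transitions `T`, case variables `V` and
activity names `A`.  Pre- and postconditions are modelled semantically, together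
with the (finite) sets of unprimed variables `readVars t` occurring in
`pre(t) ∧ post(t)` and of primed variables `writeVars t` occurring in `post(t)`;
the conditions only depend on those variables. The data domain is `Δ = ℚ`. -/
structure DPN (P T V A : Type) where
  flowPT : P → T → Bool
  flowTP : T → P → Bool
  label : T → A
  readVars : T → Finset V
  writeVars : T → Finset V
  preCond : T → (V → ℚ) → Prop
  postCond : T → (V → ℚ) → (V → ℚ) → Prop
  pre_dep : ∀ t f g, (∀ v ∈ readVars t, f v = g v) → (preCond t f ↔ preCond t g)
  post_dep : ∀ t f g f' g', (∀ v ∈ readVars t, f v = g v) →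
      (∀ v ∈ writeVars t, f' v = g' v) → (postCond t f f' ↔ postCond t g g')

variable {P T V A : Type}

/-- A state `(M, α)` of a DPN: a marking and a valuation of the case variables. -/
abbrev NState (P V : Type) := (P → ℕ) × (V → ℚ)

/-- A step `(t, β)`: a transition together with a partial valuation `β`
(on the unprimed variables, `bu`, and on the primed variables, `bp`). -/
structure PStep (T V : Type) where
  tr : T
  bu : V → Option ℚ
  bp : V → Option ℚ

/-- Total extension of the unprimed part of `β`. -/
def PStep.totu (stp : PStep T V) : V → ℚ := fun v => (stp.bu v).getD 0

/-- Total extension of the primed part of `β`. -/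
def PStep.totp (stp : PStep T V) : V → ℚ := fun v => (stp.bp v).getD 0

/-- `β` is defined exactly on the variables of `pre(t)` and `post(t)` and agrees
with `α` on the unprimed variables. -/
def Matches (N : DPN P T V A) (α : V → ℚ) (stp : PStep T V) : Prop :=
  (∀ v, (stp.bu v).isSome ↔ v ∈ N.readVars stp.tr) ∧
  (∀ v, (stp.bp v).isSome ↔ v ∈ N.writeVars stp.tr) ∧
  (∀ v ∈ N.readVars stp.tr, stp.bu v = some (α v))

/-- The step `(t,β)` is enabled in `(M,α)`:  `(M,α)[(t,β)⟩`. -/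
def Enabled (N : DPN P T V A) (st : NState P V) (stp : PStep T V) : Prop :=
  Matches N st.2 stp ∧
  (∀ p, N.flowPT p stp.tr = true → 1 ≤ st.1 p) ∧
  N.preCond stp.tr stp.totu ∧
  N.postCond stp.tr stp.totu stp.totp

/-- The marking after firing `t`. -/
def fireM (N : DPN P T V A) (M : P → ℕ) (t : T) : P → ℕ :=
  fun p => M p - (if N.flowPT p t then 1 else 0) + (if N.flowTP t p then 1 else 0)

/-- The valuation after firing the step. -/
def fireV (N : DPN P T V A) (α : V → ℚ) (stp : PStep T V) : V → ℚ :=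
  fun v => if v ∈ N.writeVars stp.tr then stp.totp v else α v

/-- `(M,α) —(t,β)→ (M',α')`. -/
def Fires (N : DPN P T V A) (st : NState P V) (stp : PStep T V) (st' : NState P V) : Prop :=
  Enabled N st stp ∧ st' = (fireM N st.1 stp.tr, fireV N st.2 stp)

/-- `(M,α) —σ→ (M',α')` for a run `σ`. -/
def RunsTo (N : DPN P T V A) : NState P V → List (PStep T V) → NState P V → Prop
  | st, [], st' => st' = st
  | st, stp :: σ, st' => ∃ st1, Fires N st stp st1 ∧ RunsTo N st1 σ st'

/-- `σ ∈ Runs(M,α,𝒢)`: no proper nonempty prefix of `σ` fired from `(M,α)`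
reaches a state in `G`. -/
def InRuns (N : DPN P T V A) (G : Set (NState P V)) (st : NState P V)
    (σ : List (PStep T V)) : Prop :=
  ∀ k, 0 < k → k < σ.length → ∀ st', RunsTo N st (σ.take k) st' → st' ∉ G

/-! ## Schedulers and likelihoods -/

/-- A scheduler of a DPN: for every state, a probability distribution over the
transitions and, for every (primed) variable, a probability distribution over `ℚ`. -/
structure Scheduler [Fintype T] (N : DPN P T V A) where
  schT : NState P V → T → ℝ≥0∞
  schV : NState P V → V → ℚ → ℝ≥0∞
  schT_dist : ∀ st, ∑ t : T, schT st t = 1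
  schV_dist : ∀ st v, ∑' q : ℚ, schV st v q = 1

variable [Fintype T]

/-- The set `enabled(M,α)` of transitions enabled in a state. -/
def enabledSet (N : DPN P T V A) (st : NState P V) : Set T :=
  {t | ∃ stp : PStep T V, stp.tr = t ∧ Enabled N st stp}

/-- Iverson bracket, valued in `ℝ≥0∞`. -/
def ind (p : Prop) : ℝ≥0∞ := if p then 1 else 0

/-- `P_𝔖[M,α](t)`: the likelihood of selecting transition `t`. -/
def transLik (N : DPN P T V A) (S : Scheduler N) (st : NState P V) (t : T) : ℝ≥0∞ :=
  (ind (t ∈ enabledSet N st) * S.schT st t) /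
    ∑ t' : T, ind (t' ∈ enabledSet N st) * S.schT st t'

/-- `P_𝔖[M,α](β | t)`: the likelihood of selecting valuation `β` given `t`. -/
def valLik (N : DPN P T V A) (S : Scheduler N) (st : NState P V) (stp : PStep T V) : ℝ≥0∞ :=
  ind (N.postCond stp.tr stp.totu stp.totp) *
    ∏ v ∈ N.writeVars stp.tr, S.schV st v (stp.totp v)

/-- `P_𝔖[M,α](t,β)`: the step likelihood. -/
def stepLik (N : DPN P T V A) (S : Scheduler N) (st : NState P V) (stp : PStep T V) : ℝ≥0∞ :=
  transLik N S st stp.tr * valLik N S st stp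

/-- `P_𝔖[M,α](σ ⊨ ◊𝒢)`: the likelihood that the run `σ` reaches `G` from `(M,α)`. -/
def runLik (N : DPN P T V A) (S : Scheduler N) (G : Set (NState P V)) :
    List (PStep T V) → NState P V → ℝ≥0∞
  | [], st => ind (st ∈ G)
  | stp :: σ', st =>
      if st ∈ G then 1
      else if Enabled N st stp then
        stepLik N S st stp * runLik N S G σ' (fireM N st.1 stp.tr, fireV N st.2 stp)
      else 0

/-- `P_𝔖[M,α](σ | ◊𝒢)`: the probability that the run `σ` reaches `G`. -/
def runProb (N : DPN P T V A) (S : Scheduler N) (G : Set (NState P V))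
    (st : NState P V) (σ : List (PStep T V)) : ℝ≥0∞ :=
  runLik N S G σ st / ∑' σ' : {σ' : List (PStep T V) // InRuns N G st σ'}, runLik N S G σ'.1 st

/-! ## The probabilistic programming language PPL -/

mutual
/-- PPL commands over program variables `Var` and messages `Msg`.
Distribution expressions, Boolean expressions, probability expressions and
message expressions are modelled semantically as functions of the program state. -/
inductive Cmd (Var Msg : Type) : Type 1 where
  | assign : Var → ((Var → ℚ) → ℚ → ℝ≥0∞) → Cmd Var Msg
  | observe : ((Var → ℚ) → Prop) → Cmd Var Msg
  | log : ((Var → ℚ) → Msg) → Cmd Var Msg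
  | seq : Cmd Var Msg → Cmd Var Msg → Cmd Var Msg
  | loop : GCmd Var Msg → Cmd Var Msg
  | iffi : GCmd Var Msg → Cmd Var Msg
/-- PPL guarded commands. -/
inductive GCmd (Var Msg : Type) : Type 1 where
  | guard : ((Var → ℚ) → Prop) → ((Var → ℚ) → ℝ≥0∞) → Cmd Var Msg → GCmd Var Msg
  | choice : GCmd Var Msg → GCmd Var Msg → GCmd Var Msg
end

/-- Pairs of a program state and a program log. -/
abbrev PSL (Var Msg : Type) := ((Var → ℚ)) × List Msg

/-- Dirac distribution. -/
def dirac {X : Type*} (a : X) : X → ℝ≥0∞ := fun b => if b = a then 1 else 0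

/-- Pointwise function update. -/
def upd {Var : Type} (s : Var → ℚ) (x : Var) (q : ℚ) : Var → ℚ :=
  fun y => if y = x then q else s y

variable {Var Msg : Type}

/-- `done(GC)`: how many guards of `GC` hold. -/
def GCmd.done : GCmd Var Msg → (Var → ℚ) → ℝ≥0∞
  | .guard B _ _, s => ind (B s)
  | .choice g1 g2, s => g1.done s + g2.done s

/-- `branchProb(GC)`: total probability of the guards of `GC` that hold. -/
def GCmd.branchProb : GCmd Var Msg → (Var → ℚ) → ℝ≥0∞
  | .guard B E _, s => ind (B s) * E s
  | .choice g1 g2, s => g1.branchProb s + g2.branchProb s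

/-- Finite unrollings of a loop:  `⟦C₀⟧ = 0` and
`⟦C_{n+1}⟧(s,ℓ) = (1 − done)·δ_{(s,ℓ)} + ⟦if GC fi; C_n⟧(s,ℓ)`, where `body`
is the semantics of `if GC fi`. -/
def iter (done : (Var → ℚ) → ℝ≥0∞) (body : PSL Var Msg → PSL Var Msg → ℝ≥0∞) :
    ℕ → PSL Var Msg → PSL Var Msg → ℝ≥0∞
  | 0, _, _ => 0
  | n + 1, sl, out =>
      (1 - done sl.1) * dirac sl out + ∑' sl', body sl sl' * iter done body n sl' out

mutual
/-- The unnormalized semantics `⟦C⟧ : PSL → subdistributions over PSL`. -/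
def sem : Cmd Var Msg → PSL Var Msg → PSL Var Msg → ℝ≥0∞
  | .assign x D, sl, out => ∑' q : ℚ, D sl.1 q * dirac (upd sl.1 x q, sl.2) out
  | .observe B, sl, out => ind (B sl.1) * dirac sl out
  | .log m, sl, out => dirac (sl.1, sl.2 ++ [m sl.1]) out
  | .seq c1 c2, sl, out => ∑' sl', sem c1 sl sl' * sem c2 sl' out
  | .iffi gc, sl, out => (gc.done sl.1 / gc.branchProb sl.1) * semGC gc sl out
  | .loop gc, sl, out =>
      ⨆ n, iter gc.done
        (fun a b => (gc.done a.1 / gc.branchProb a.1) * semGC gc a b) n sl out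
/-- The unnormalized semantics of guarded commands. -/
def semGC : GCmd Var Msg → PSL Var Msg → PSL Var Msg → ℝ≥0∞
  | .guard B E c, sl, out => ind (B sl.1) * E sl.1 * sem c sl out
  | .choice g1 g2, sl, out => semGC g1 sl out + semGC g2 sl out
end

/-- The normalized semantics `⎣C⎦`. -/
def nsem (c : Cmd Var Msg) (sl : PSL Var Msg) : PSL Var Msg → ℝ≥0∞ :=
  fun out => sem c sl out / ∑' out', sem c sl out'

/-- The `n`-th finite unrolling of `do GC od`. -/
def unroll (gc : GCmd Var Msg) (n : ℕ) : PSL Var Msg → PSL Var Msg → ℝ≥0∞ :=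
  iter gc.done (fun a b => (gc.done a.1 / gc.branchProb a.1) * semGC gc a b) n

/-! ## Encoding a DPN into PPL -/

/-- Program variables of the encoding: one variable `p̲` per place, and
variables `v̲` (unprimed) and `v̲'` (primed) per case variable. -/
abbrev PVar (P V : Type) := P ⊕ (V ⊕ V)

/-- `p̲`. -/
def pl (p : P) : PVar P V := Sum.inl p
/-- `v̲`. -/
def unpr (v : V) : PVar P V := Sum.inr (Sum.inl v)
/-- `v̲'`. -/
def prm (v : V) : PVar P V := Sum.inr (Sum.inr v)

/-- `s_{M,α}`: the unique observable program state encoding `(M,α)`. -/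
def obsState (st : NState P V) : PVar P V → ℚ
  | Sum.inl p => st.1 p
  | Sum.inr (Sum.inl v) => st.2 v
  | Sum.inr (Sum.inr v) => st.2 v

/-- A program state is observable iff primed and unprimed variables agree. -/
def Observable (s : PVar P V → ℚ) : Prop := ∀ v : V, s (unpr v) = s (prm v)

/-- The marking `M_s` decoded from a program state. -/
def decodeM (s : PVar P V → ℚ) : P → ℕ := fun p => (⌊s (pl p)⌋).toNat

/-- The valuation `α_s` decoded from a program state. -/
def decodeV (s : PVar P V → ℚ) : V → ℚ := fun v => s (unpr v)

/-- The net state decoded from a program state. -/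
def decodeSt (s : PVar P V → ℚ) : NState P V := (decodeM s, decodeV s)

/-- A skip command (observe true). -/
def skip : Cmd Var Msg := .observe (fun _ => True)

/-- Sequential composition of a list of commands. -/
def seqAll (l : List (Cmd Var Msg)) : Cmd Var Msg := l.foldr .seq skip

/-- Deterministic assignment `x := E`: sample from the Dirac distribution on `E`. -/
def detAssign (x : Var) (E : (Var → ℚ) → ℚ) : Cmd Var Msg :=
  .assign x (fun s q => ind (q = E s))

variable [Fintype P] [Fintype V] [DecidableEq V]

/-- The preset `•t`, as a list. -/
def presetL (N : DPN P T V A) (t : T) : List P :=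
  (Finset.univ.filter fun p => N.flowPT p t).toList

/-- The postset `t•`, as a list. -/
def postsetL (N : DPN P T V A) (t : T) : List P :=
  (Finset.univ.filter fun p => N.flowTP t p).toList

/-- The message `step(t)`: the step `(t,β)` read off the current program state. -/
def getStep (N : DPN P T V A) (t : T) (s : PVar P V → ℚ) : PStep T V :=
  ⟨t, fun v => if v ∈ N.readVars t then some (s (unpr v)) else none,
      fun v => if v ∈ N.writeVars t then some (s (prm v)) else none⟩

/-- `⟨post(t)⟩`: the postcondition of `t` over the program variables. -/
def postExpr (N : DPN P T V A) (t : T) (s : PVar P V → ℚ) : Prop :=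
  N.postCond t (fun v => s (unpr v)) (fun v => s (prm v))

/-- `B_enabled(t) = ⟨pre(t)⟩ ∧ ⋀_{p ∈ •t} p̲ ≥ 1`. -/
def Benabled (N : DPN P T V A) (t : T) (s : PVar P V → ℚ) : Prop :=
  N.preCond t (fun v => s (unpr v)) ∧ ∀ p : P, N.flowPT p t = true → 1 ≤ s (pl p)

/-- `C_fire(t)`. -/
def Cfire (N : DPN P T V A) (S : Scheduler N) (t : T) : Cmd (PVar P V) (PStep T V) :=
  .seq (seqAll ((presetL N t).map fun p => detAssign (pl p) (fun s => s (pl p) - 1)))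
  (.seq (seqAll ((postsetL N t).map fun p => detAssign (pl p) (fun s => s (pl p) + 1)))
  (.seq (seqAll ((N.writeVars t).toList.map fun v =>
          .assign (prm v) (fun s q => S.schV (decodeSt s) v q)))
  (.seq (.observe (postExpr N t))
  (.seq (.log (getStep N t))
        (seqAll ((N.writeVars t).toList.map fun v =>
          detAssign (unpr v) (fun s => s (prm v))))))))

/-- One branch of the main loop's guarded command. -/
def branch (N : DPN P T V A) (S : Scheduler N) (G : Set (NState P V)) (t : T) :
    GCmd (PVar P V) (PStep T V) :=
  .guard (fun s => decodeSt s ∉ G ∧ Benabled N t s)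
         (fun s => S.schT (decodeSt s) t)
         (Cfire N S t)

/-- The guarded command `GC_body` of the main loop (a choice over all transitions;
the trailing dummy branch has a false guard and probability `0`, hence is
semantically inert). -/
def GCbody (N : DPN P T V A) (S : Scheduler N) (G : Set (NState P V)) :
    GCmd (PVar P V) (PStep T V) :=
  ((Finset.univ : Finset T).toList.map (branch N S G)).foldr .choice
    (.guard (fun _ => False) (fun _ => 0) skip)

/-- The main loop `C_loop = do GC_body od`. -/
def Cloop (N : DPN P T V A) (S : Scheduler N) (G : Set (NState P V)) :
    Cmd (PVar P V) (PStep T V) :=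
  .loop (GCbody N S G)

/-- `C_init`: initialization of the encoded net state. -/
def Cinit (N : DPN P T V A) (st0 : NState P V) : Cmd (PVar P V) (PStep T V) :=
  seqAll (((Finset.univ : Finset P).toList.map fun p =>
            detAssign (pl p) (fun _ => (st0.1 p : ℚ)))
        ++ ((Finset.univ : Finset V).toList.map fun v =>
            detAssign (unpr v) (fun _ => st0.2 v))
        ++ ((Finset.univ : Finset V).toList.map fun v =>
            detAssign (prm v) (fun _ => st0.2 v)))

/-- The full encoding `C_N = C_init; C_loop`. -/
def CN (N : DPN P T V A) (S : Scheduler N) (G : Set (NState P V)) (st0 : NState P V) :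
    Cmd (PVar P V) (PStep T V) :=
  .seq (Cinit N st0) (Cloop N S G)

/-- `𝒢` contains all deadlocked states. -/
def DeadlockedIn (N : DPN P T V A) (G : Set (NState P V)) : Prop :=
  ∀ st : NState P V, (∀ stp : PStep T V, ¬ Enabled N st stp) → st ∈ G

end

section Helpers

lemma tsum_pos_exists {X : Type*} {f : X → ℝ≥0∞} (h : 0 < ∑' x, f x) : ∃ x, 0 < f x := by
  by_contra hc
  push Not at hc
  have : ∀ x, f x = 0 := fun x => le_antisymm (hc x) bot_le
  simp [this] at h

lemma mul_pos_both {a b : ℝ≥0∞} (h : 0 < a * b) : 0 < a ∧ 0 < b := by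
  constructor
  · rcases eq_or_ne a 0 with h0 | h0
    · simp [h0] at h
    · exact pos_iff_ne_zero.2 h0
  · rcases eq_or_ne b 0 with h0 | h0
    · simp [h0] at h
    · exact pos_iff_ne_zero.2 h0

lemma dirac_pos {X : Type*} {a b : X} (h : 0 < dirac a b) : b = a := by
  unfold dirac at h
  split_ifs at h with h'
  · exact h'
  · simp at h

lemma ind_pos {p : Prop} (h : 0 < ind p) : p := by
  unfold ind at h
  split_ifs at h with h'
  · exact h'
  · simp at h

variable {Var Msg : Type}

lemma seq_pos {c1 c2 : Cmd Var Msg} {sl out : PSL Var Msg} (h : 0 < sem (.seq c1 c2) sl out) :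
    ∃ m, 0 < sem c1 sl m ∧ 0 < sem c2 m out := by
  rw [sem] at h
  obtain ⟨m, hm⟩ := tsum_pos_exists h
  exact ⟨m, mul_pos_both hm⟩

lemma assign_pos {x : Var} {D} {sl out : PSL Var Msg} (h : 0 < sem (.assign x D) sl out) :
    ∃ q, 0 < D sl.1 q ∧ out = (upd sl.1 x q, sl.2) := by
  rw [sem] at h
  obtain ⟨q, hm⟩ := tsum_pos_exists h
  exact ⟨q, (mul_pos_both hm).1, dirac_pos (mul_pos_both hm).2⟩

lemma detAssign_pos {x : Var} {E} {sl out : PSL Var Msg} (h : 0 < sem (detAssign x E) sl out) :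
    out = (upd sl.1 x (E sl.1), sl.2) := by
  obtain ⟨q, hq, rfl⟩ := assign_pos h
  rw [ind_pos hq]

lemma observe_pos {B} {sl out : PSL Var Msg} (h : 0 < sem (.observe B) sl out) :
    B sl.1 ∧ out = sl := by
  rw [sem] at h
  exact ⟨ind_pos (mul_pos_both h).1, dirac_pos (mul_pos_both h).2⟩

lemma log_pos {m} {sl out : PSL Var Msg} (h : 0 < sem (.log m) sl out) :
    out = (sl.1, sl.2 ++ [m sl.1]) := by
  rw [sem] at h
  exact dirac_pos h

variable {P T V A : Type}

lemma places_pos (f : ℚ → ℚ) (l : List P) (hl : l.Nodup) :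
    ∀ (sl out : PSL (PVar P V) Msg),
    0 < sem (seqAll (l.map fun p => detAssign (pl p) (fun s => f (s (pl p))))) sl out →
    out.2 = sl.2 ∧ (∀ x, out.1 (Sum.inr x) = sl.1 (Sum.inr x)) ∧
      ∀ p, out.1 (pl p) = if p ∈ l then f (sl.1 (pl p)) else sl.1 (pl p) := by
  induction l with
  | nil =>
    intro sl out h
    obtain ⟨-, rfl⟩ := observe_pos h
    simp
  | cons a l ih =>
    intro sl out h
    obtain ⟨m, hm, h⟩ := seq_pos h
    obtain ⟨e1, e2, e3⟩ := ih hl.of_cons m out h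
    have := detAssign_pos hm
    subst this
    have hal : a ∉ l := (List.nodup_cons.1 hl).1
    refine ⟨e1, fun x => by simp [e2, upd, pl], fun p => ?_⟩
    rw [e3]
    by_cases hp : p = a
    · subst hp
      simp [hal, upd]
    · simp [hp, upd, pl]

lemma sample_pos (D : V → (PVar P V → ℚ) → ℚ → ℝ≥0∞) (l : List V) :
    ∀ (sl out : PSL (PVar P V) Msg),
    0 < sem (seqAll (l.map fun v => .assign (prm v) (D v))) sl out →
    out.2 = sl.2 ∧ (∀ p, out.1 (pl p) = sl.1 (pl p)) ∧ (∀ v, out.1 (unpr v) = sl.1 (unpr v)) ∧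
      ∀ v, v ∉ l → out.1 (prm v) = sl.1 (prm v) := by
  induction l with
  | nil =>
    intro sl out h
    obtain ⟨-, rfl⟩ := observe_pos h
    simp
  | cons a l ih =>
    intro sl out h
    obtain ⟨m, hm, h⟩ := seq_pos h
    obtain ⟨e1, e2, e3, e4⟩ := ih m out h
    obtain ⟨q, -, rfl⟩ := assign_pos hm
    refine ⟨e1, fun x => by rw [e2]; simp [upd, pl, prm], fun x => by rw [e3]; simp [upd, unpr, prm],
      fun v hv => ?_⟩
    rw [List.mem_cons, not_or] at hv
    rw [e4 v hv.2]
    simp [upd, prm, hv.1]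

lemma copy_pos (l : List V) :
    ∀ (sl out : PSL (PVar P V) Msg),
    0 < sem (seqAll (l.map fun v => detAssign (unpr v) (fun s => s (prm v)))) sl out →
    out.2 = sl.2 ∧ (∀ p, out.1 (pl p) = sl.1 (pl p)) ∧ (∀ v, out.1 (prm v) = sl.1 (prm v)) ∧
      ∀ v, out.1 (unpr v) = if v ∈ l then sl.1 (prm v) else sl.1 (unpr v) := by
  induction l with
  | nil =>
    intro sl out h
    obtain ⟨-, rfl⟩ := observe_pos h
    simp
  | cons a l ih =>
    intro sl out h
    obtain ⟨m, hm, h⟩ := seq_pos h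
    obtain ⟨e1, e2, e3, e4⟩ := ih m out h
    have := detAssign_pos hm
    subst this
    refine ⟨e1, fun x => by rw [e2]; simp [upd, pl, unpr], fun x => by rw [e3]; simp [upd, unpr, prm],
      fun v => ?_⟩
    rw [e4 v]
    by_cases hv : v = a
    · subst hv
      simp [upd, prm, unpr]
    · simp [hv, upd, prm, unpr]

variable [Fintype P] [Fintype T] [Fintype V] [DecidableEq V]

lemma decodeSt_obsState (st : NState P V) : decodeSt (obsState st) = st := by
  ext x
  · simp [decodeSt, decodeM, obsState, pl]
  · simp [decodeSt, decodeV, obsState, unpr]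

lemma Cfire_pos (N : DPN P T V A) (S : Scheduler N) (t : T) (st : NState P V)
    (σ : List (PStep T V)) (out : PSL (PVar P V) (PStep T V))
    (hB : Benabled N t (obsState st))
    (h : 0 < sem (Cfire N S t) (obsState st, σ) out) :
    ∃ stp st1, Fires N st stp st1 ∧ out = (obsState st1, σ ++ [stp]) := by
  obtain ⟨m1, k1, h⟩ := seq_pos h
  obtain ⟨m2, k2, h⟩ := seq_pos h
  obtain ⟨m3, k3, h⟩ := seq_pos h
  obtain ⟨m4, k4, h⟩ := seq_pos h
  obtain ⟨m5, k5, h⟩ := seq_pos h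
  obtain ⟨a1, a2, a3⟩ := places_pos (fun q => q - 1) _ (Finset.nodup_toList _) _ _ k1
  obtain ⟨b1, b2, b3⟩ := places_pos (fun q => q + 1) _ (Finset.nodup_toList _) _ _ k2
  obtain ⟨c1, c2, c3, c4⟩ := sample_pos (fun v s q => S.schV (decodeSt s) v q) _ _ _ k3
  obtain ⟨hpost, d⟩ := observe_pos k4
  have e := log_pos k5
  obtain ⟨f1, f2, f3, f4⟩ := copy_pos _ _ _ h
  subst d
  subst e
  have hu : ∀ v, m4.1 (unpr v) = st.2 v := fun v => by
    rw [c3]; unfold unpr; rw [b2, a2]; rfl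
  have hp : ∀ v, v ∉ N.writeVars t → m4.1 (prm v) = st.2 v := fun v hv => by
    rw [c4 v (by simpa using hv)]; unfold prm; rw [b2, a2]; rfl
  have hM : ∀ p, N.flowPT p t = true → 1 ≤ st.1 p := fun p hp => by
    have := hB.2 p hp
    simpa [obsState, pl] using this
  have tu : ∀ v ∈ N.readVars t, (getStep N t m4.1).totu v = st.2 v := fun v hv => by
    simp [PStep.totu, getStep, hv, hu]
  have tp : ∀ v ∈ N.writeVars t, (getStep N t m4.1).totp v = m4.1 (prm v) := fun v hv => by
    simp [PStep.totp, getStep, hv]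
  refine ⟨getStep N t m4.1, _, ⟨⟨⟨?_, ?_, ?_⟩, hM, ?_, ?_⟩, rfl⟩, ?_⟩
  · intro v; simp [getStep]
  · intro v; simp [getStep]
  · intro v hv
    have hv' : v ∈ N.readVars t := hv
    simp [getStep, hv', hu]
  · exact (N.pre_dep t _ _ fun v hv => by rw [tu v hv]; rfl).1 hB.1
  · exact (N.post_dep t _ _ _ _ (fun v hv => by rw [tu v hv, hu])
      (fun v hv => (tp v hv).symm)).1 hpost
  · refine Prod.ext (funext ?_) ?_
    · rintro (p | v | v)
      · have := f2 p
        change out.1 (pl p) = ((fireM N st.1 t p : ℕ) : ℚ)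
        rw [this]
        change m4.1 (pl p) = _
        rw [c2, b3, a3]
        have h1 : (obsState st (pl p) : ℚ) = (st.1 p : ℚ) := rfl
        simp only [h1, fireM, presetL, postsetL, Finset.mem_toList, Finset.mem_filter,
          Finset.mem_univ, true_and]
        by_cases hq : N.flowPT p t = true
        · have := hM p hq
          by_cases hr : N.flowTP t p = true <;> simp [hq, hr, Nat.cast_sub this]
        · by_cases hr : N.flowTP t p = true <;> simp [hq, hr]
      · have := f4 v
        change out.1 (unpr v) = fireV N st.2 (getStep N t m4.1) v
        rw [this]
        by_cases hv : v ∈ N.writeVars t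
        · have hv' : v ∈ N.writeVars (getStep N t m4.1).tr := hv
          simp [fireV, hv, hv', tp]
        · have hv' : v ∉ N.writeVars (getStep N t m4.1).tr := hv
          simp [fireV, hv, hv', hu]
      · have := f3 v
        change out.1 (prm v) = fireV N st.2 (getStep N t m4.1) v
        rw [this]
        by_cases hv : v ∈ N.writeVars t
        · have hv' : v ∈ N.writeVars (getStep N t m4.1).tr := hv
          simp [fireV, hv', tp v hv]
        · have hv' : v ∉ N.writeVars (getStep N t m4.1).tr := hv
          simp [fireV, hv', hp v hv]
    · rw [f1]
      change m4.2 ++ _ = _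
      rw [c1, b1, a1]

lemma GCbody_pos (N : DPN P T V A) (S : Scheduler N) (G : Set (NState P V)) (st : NState P V)
    (σ : List (PStep T V)) (out : PSL (PVar P V) (PStep T V))
    (h : 0 < semGC (GCbody N S G) (obsState st, σ) out) :
    st ∉ G ∧ ∃ stp st1, Fires N st stp st1 ∧ out = (obsState st1, σ ++ [stp]) := by
  unfold GCbody at h
  generalize (Finset.univ : Finset T).toList = L at h
  induction L with
  | nil =>
    simp [semGC, ind] at h
  | cons t l ih =>
    rw [List.map_cons, List.foldr_cons, semGC] at h
    rcases add_pos_iff.1 h with h | h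
    · rw [branch, semGC] at h
      have hb := ind_pos (mul_pos_both (mul_pos_both h).1).1
      dsimp only at hb
      rw [decodeSt_obsState] at hb
      exact ⟨hb.1, Cfire_pos N S t st σ out hb.2 (mul_pos_both h).2⟩
    · exact ih h

lemma RunsTo_det (N : DPN P T V A) (σ : List (PStep T V)) : ∀ (a b c : NState P V),
    RunsTo N a σ b → RunsTo N a σ c → b = c := by
  induction σ with
  | nil => intro a b c h h'; exact h.trans h'.symm
  | cons x σ ih =>
    rintro a b c ⟨d, ⟨-, rfl⟩, hd⟩ ⟨e, ⟨-, rfl⟩, he⟩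
    exact ih _ _ _ hd he

lemma RunsTo_snoc (N : DPN P T V A) (x : PStep T V) (σ : List (PStep T V)) :
    ∀ (a b c : NState P V), RunsTo N a σ b → Fires N b x c → RunsTo N a (σ ++ [x]) c := by
  induction σ with
  | nil => rintro a b c h h'; cases h; exact ⟨c, h', rfl⟩
  | cons y σ ih =>
    rintro a b c ⟨d, hf, hd⟩ h'
    exact ⟨d, hf, ih _ _ _ hd h'⟩

lemma iter_pos (N : DPN P T V A) (S : Scheduler N) (G : Set (NState P V)) (st0 : NState P V)
    (n : ℕ) : ∀ (st : NState P V) (σ : List (PStep T V)) (out : PSL (PVar P V) (PStep T V)),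
    InRuns N G st0 σ → RunsTo N st0 σ st →
    0 < iter (GCbody N S G).done
        (fun a b => ((GCbody N S G).done a.1 / (GCbody N S G).branchProb a.1) *
          semGC (GCbody N S G) a b) n (obsState st, σ) out →
    ∃ σ' st', out = (obsState st', σ ++ σ') ∧ InRuns N G st0 (σ ++ σ') ∧ RunsTo N st σ' st' := by
  induction n with
  | zero => intro st σ out _ _ h; simp [iter] at h
  | succ n ih =>
    intro st σ out h1 h2 h
    rw [iter] at h
    rcases add_pos_iff.1 h with h | h
    · exact ⟨[], st, by simpa using dirac_pos (mul_pos_both h).2, by simpa using h1, rfl⟩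
    · obtain ⟨m, hm⟩ := tsum_pos_exists h
      obtain ⟨hb, hi⟩ := mul_pos_both hm
      obtain ⟨hG, stp, st1, hf, rfl⟩ := GCbody_pos N S G st σ m (mul_pos_both hb).2
      have h1' : InRuns N G st0 (σ ++ [stp]) := by
        intro k k0 k1 st' hr
        have hk : k ≤ σ.length := by simp at k1; omega
        rw [List.take_append_of_le_length hk] at hr
        rcases hk.lt_or_eq with hk | hk
        · exact h1 k k0 hk st' hr
        · rw [hk, List.take_length] at hr
          rwa [RunsTo_det N σ _ _ _ hr h2]
      obtain ⟨σ', st', e1, e2, e3⟩ := ih st1 (σ ++ [stp]) out h1' (RunsTo_snoc N _ _ _ _ _ h2 hf) hi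
      refine ⟨stp :: σ', st', by simpa using e1, by simpa using e2, st1, hf, e3⟩

end Helpers

/-- generalized invariant of Lemma 4: if `σ ∈ Runs(M₀,α₀,𝒢)`,
`(M₀,α₀) —σ→ (M,α)`, and `⟦C_loop⟧(s_{M,α},σ)(s',σσ') > 0`, then
`σσ' ∈ Runs(M₀,α₀,𝒢)`, `s'` is observable, and `(M,α) —σ'→ (M_{s'},α_{s'})` for
the marking and valuation decoded from `s'`. -/
theorem loop_pos_invariant {P T V A : Type} [Fintype P] [Fintype T] [Fintype V]
    [DecidableEq V] (N : DPN P T V A) (S : Scheduler N) (G : Set (NState P V))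
    (hG : DeadlockedIn N G) (st0 st : NState P V)
    (σ σ' : List (PStep T V)) (s' : PVar P V → ℚ)
    (h1 : InRuns N G st0 σ) (h2 : RunsTo N st0 σ st)
    (h3 : 0 < sem (Cloop N S G) (obsState st, σ) (s', σ ++ σ')) :
    InRuns N G st0 (σ ++ σ') ∧ Observable s' ∧
      ∃ M' : P → ℕ, (∀ p : P, (M' p : ℚ) = s' (pl p)) ∧
        RunsTo N st σ' (M', decodeV s') := by
  rw [Cloop, sem] at h3
  obtain ⟨n, hn⟩ := lt_iSup_iff.1 h3
  obtain ⟨τ, st', e1, e2, e3⟩ := iter_pos N S G st0 n st σ _ h1 h2 hn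
  obtain ⟨rfl, e⟩ := Prod.mk.inj e1
  obtain rfl := List.append_cancel_left e
  exact ⟨e2, fun v => rfl, st'.1, fun p => rfl, e3⟩
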